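/- Let g, M ∈ ℝ^{m×n} and let P = polar(M) be the polar factor of M. Then ⟨g, P⟩_F ≥ ‖g‖_* − 2‖g − M‖_*, where ⟨·,·⟩_F is the Frobenius (trace) inner product and ‖·‖_* is the nuclear norm. -/

import Mathlib

open Matrix MeasureTheory Finset Filter

noncomputable section

/-- Real `m × n` matrices. -/
abbrev Mat (m n : ℕ) := Matrix (Fin m) (Fin n) ℝ

/-- Frobenius (trace) inner product `⟨A, B⟩_F = tr(Aᵀ B)`. -/
def frobInner {m n : ℕ} (A B : Mat m n) : ℝ := ∑ i, ∑ j, A i j * B i j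

/-- Frobenius norm. -/
def frobNorm {m n : ℕ} (A : Mat m n) : ℝ := Real.sqrt (∑ i, ∑ j, (A i j) ^ 2)

/-- Spectral norm (`ℓ₂ → ℓ₂` operator norm, i.e. largest singular value). -/
def specNorm {m n : ℕ} (A : Mat m n) : ℝ :=
  sSup {c : ℝ | ∃ u : Fin n → ℝ, (∑ j, (u j) ^ 2) ≤ 1 ∧
    c = Real.sqrt (∑ i, (A.mulVec u i) ^ 2)}

/-- Nuclear norm (sum of singular values), via duality with the spectral norm. -/
def nucNorm {m n : ℕ} (A : Mat m n) : ℝ :=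
  sSup {c : ℝ | ∃ Q : Mat m n, specNorm Q ≤ 1 ∧ c = frobInner A Q}

/-- `P` is the polar factor `U Vᵀ` of a compact SVD `M = U Σ Vᵀ`
(`U`, `V` with orthonormal columns, `Σ` positive diagonal). -/
def IsPolarFactor {m n : ℕ} (M P : Mat m n) : Prop :=
  ∃ (k : ℕ) (U : Matrix (Fin m) (Fin k) ℝ) (V : Matrix (Fin n) (Fin k) ℝ)
    (s : Fin k → ℝ),
    Uᵀ * U = 1 ∧ Vᵀ * V = 1 ∧ (∀ i, 0 < s i) ∧
    M = U * Matrix.diagonal s * Vᵀ ∧ P = U * Vᵀ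

/-- `gradf` is the gradient of `f` with respect to the Frobenius inner product:
along every line `s ↦ A + s • H`, `f` has derivative `⟨gradf A, H⟩_F` at `s = 0`. -/
def IsGradient {m n : ℕ} (f : Mat m n → ℝ) (gradf : Mat m n → Mat m n) : Prop :=
  ∀ A H : Mat m n, HasDerivAt (fun s : ℝ => f (A + s • H)) (frobInner (gradf A) H) 0

theorem sum_sq_eq_dotProduct {ι : Type*} [Fintype ι] (x : ι → ℝ) :
    ∑ i, x i ^ 2 = x ⬝ᵥ x := by
  simp [dotProduct, sq]

theorem dotProduct_self_nonneg_real {ι : Type*} [Fintype ι] (x : ι → ℝ) : 0 ≤ x ⬝ᵥ x := by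
  rw [← sum_sq_eq_dotProduct]
  positivity

theorem frobInner_eq_trace {m n : ℕ} (A B : Mat m n) : frobInner A B = (Aᵀ * B).trace := by
  simp only [frobInner, trace, diag_apply, mul_apply, transpose_apply]
  exact Finset.sum_comm

theorem bddAbove_specNorm {m n : ℕ} (A : Mat m n) :
    BddAbove {c : ℝ | ∃ u : Fin n → ℝ, (∑ j, (u j) ^ 2) ≤ 1 ∧
      c = Real.sqrt (∑ i, (A.mulVec u i) ^ 2)} := by
  refine ⟨frobNorm A, ?_⟩
  rintro c ⟨u, hu, rfl⟩
  refine Real.sqrt_le_sqrt (Finset.sum_le_sum fun i _ => ?_)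
  have hA : 0 ≤ ∑ j, (A i j) ^ 2 := by positivity
  calc (A.mulVec u i) ^ 2 ≤ (∑ j, (A i j) ^ 2) * ∑ j, (u j) ^ 2 :=
        Finset.sum_mul_sq_le_sq_mul_sq Finset.univ (A i) u
    _ ≤ ∑ j, (A i j) ^ 2 := mul_le_of_le_one_right hA hu

theorem mulVec_dotProduct_self_le_one {m n : ℕ} {Q : Mat m n} (hQ : specNorm Q ≤ 1)
    {u : Fin n → ℝ} (hu : u ⬝ᵥ u ≤ 1) : (Q *ᵥ u) ⬝ᵥ (Q *ᵥ u) ≤ 1 := by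
  have h := (le_csSup (bddAbove_specNorm Q)
    ⟨u, (sum_sq_eq_dotProduct u).trans_le hu, rfl⟩).trans hQ
  rwa [Real.sqrt_le_one, sum_sq_eq_dotProduct] at h

theorem specNorm_le_one {m n : ℕ} {Q : Mat m n}
    (h : ∀ u : Fin n → ℝ, (Q *ᵥ u) ⬝ᵥ (Q *ᵥ u) ≤ u ⬝ᵥ u) : specNorm Q ≤ 1 := by
  refine Real.sSup_le ?_ zero_le_one
  rintro c ⟨u, hu, rfl⟩
  rw [Real.sqrt_le_one, sum_sq_eq_dotProduct]
  exact (h u).trans ((sum_sq_eq_dotProduct u).symm.trans_le hu)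

theorem dotProduct_mulVec_le_one {m n : ℕ} {Q : Mat m n} (hQ : specNorm Q ≤ 1)
    {x : Fin m → ℝ} {u : Fin n → ℝ} (hx : x ⬝ᵥ x ≤ 1) (hu : u ⬝ᵥ u ≤ 1) :
    x ⬝ᵥ (Q *ᵥ u) ≤ 1 := by
  have h := mulVec_dotProduct_self_le_one hQ hu
  have h' := dotProduct_self_nonneg_real (x - Q *ᵥ u)
  rw [sub_dotProduct, dotProduct_sub, dotProduct_sub, dotProduct_comm (Q *ᵥ u) x] at h'
  linarith

theorem specNorm_neg {m n : ℕ} (Q : Mat m n) : specNorm (-Q) = specNorm Q := by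
  simp [specNorm, neg_mulVec]

theorem abs_apply_le_one {m n : ℕ} {Q : Mat m n} (hQ : specNorm Q ≤ 1) (i : Fin m) (j : Fin n) :
    |Q i j| ≤ 1 := by
  have key : ∀ R : Mat m n, specNorm R ≤ 1 → R i j ≤ 1 := fun R hR => by
    simpa using dotProduct_mulVec_le_one hR (x := Pi.single i 1) (u := Pi.single j 1)
      (by simp) (by simp)
  exact abs_le'.2 ⟨key Q hQ, key (-Q) ((specNorm_neg Q).trans_le hQ)⟩

theorem frobInner_le_nucNorm {m n : ℕ} (A : Mat m n) {Q : Mat m n} (hQ : specNorm Q ≤ 1) :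
    frobInner A Q ≤ nucNorm A := by
  refine le_csSup ⟨∑ i, ∑ j, |A i j|, ?_⟩ ⟨Q, hQ, rfl⟩
  rintro c ⟨R, hR, rfl⟩
  refine Finset.sum_le_sum fun i _ => Finset.sum_le_sum fun j _ => ?_
  calc A i j * R i j ≤ |A i j| * |R i j| := (le_abs_self _).trans (abs_mul _ _).le
    _ ≤ |A i j| := mul_le_of_le_one_right (abs_nonneg _) (abs_apply_le_one hR i j)

theorem mulVec_dotProduct_mulVec_of_orthonormal {m k : ℕ} {U : Matrix (Fin m) (Fin k) ℝ}
    (hU : Uᵀ * U = 1) (w : Fin k → ℝ) : (U *ᵥ w) ⬝ᵥ (U *ᵥ w) = w ⬝ᵥ w := by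
  rw [dotProduct_mulVec, ← mulVec_transpose, mulVec_mulVec, hU, one_mulVec]

theorem transpose_mulVec_dotProduct_le_of_orthonormal {n k : ℕ} {V : Matrix (Fin n) (Fin k) ℝ}
    (hV : Vᵀ * V = 1) (u : Fin n → ℝ) : (Vᵀ *ᵥ u) ⬝ᵥ (Vᵀ *ᵥ u) ≤ u ⬝ᵥ u := by
  have h := dotProduct_self_nonneg_real (u - V *ᵥ (Vᵀ *ᵥ u))
  have hc : u ⬝ᵥ (V *ᵥ (Vᵀ *ᵥ u)) = (Vᵀ *ᵥ u) ⬝ᵥ (Vᵀ *ᵥ u) := by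
    rw [dotProduct_mulVec, ← mulVec_transpose]
  rw [sub_dotProduct, dotProduct_sub, dotProduct_sub, dotProduct_comm (V *ᵥ (Vᵀ *ᵥ u)) u, hc,
    mulVec_dotProduct_mulVec_of_orthonormal hV] at h
  linarith

theorem IsPolarFactor.specNorm_le_one {m n : ℕ} {M P : Mat m n} (hP : IsPolarFactor M P) :
    specNorm P ≤ 1 := by
  obtain ⟨k, U, V, s, hU, hV, -, -, rfl⟩ := hP
  refine _root_.specNorm_le_one fun u => ?_
  rw [← mulVec_mulVec, mulVec_dotProduct_mulVec_of_orthonormal hU]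
  exact transpose_mulVec_dotProduct_le_of_orthonormal hV u

theorem frobInner_mul_diagonal_mul {m n k : ℕ} (U : Matrix (Fin m) (Fin k) ℝ)
    (V : Matrix (Fin n) (Fin k) ℝ) (s : Fin k → ℝ) (Q : Mat m n) :
    frobInner (U * diagonal s * Vᵀ) Q = ∑ l, s l * (Uᵀ * (Q * V)) l l := by
  rw [frobInner_eq_trace, transpose_mul, transpose_mul, transpose_transpose, diagonal_transpose,
    Matrix.mul_assoc, trace_mul_comm, Matrix.mul_assoc, Matrix.mul_assoc]
  simp [trace]

theorem IsPolarFactor.frobInner_le {m n : ℕ} {M P Q : Mat m n} (hP : IsPolarFactor M P)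
    (hQ : specNorm Q ≤ 1) : frobInner M Q ≤ frobInner M P := by
  obtain ⟨k, U, V, s, hU, hV, hs, rfl, rfl⟩ := hP
  rw [frobInner_mul_diagonal_mul, frobInner_mul_diagonal_mul]
  refine Finset.sum_le_sum fun l _ => mul_le_mul_of_nonneg_left ?_ (hs l).le
  have hP : Uᵀ * (U * Vᵀ * V) = 1 := by
    rw [Matrix.mul_assoc, hV, Matrix.mul_one, hU]
  rw [hP, one_apply_eq]
  have hu : U.col l ⬝ᵥ U.col l ≤ 1 := (congrFun₂ hU l l).le.trans (one_apply_eq l).le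
  have hv : V.col l ⬝ᵥ V.col l ≤ 1 := (congrFun₂ hV l l).le.trans (one_apply_eq l).le
  exact dotProduct_mulVec_le_one hQ hu hv

theorem frobInner_sub_left {m n : ℕ} (A B Q : Mat m n) :
    frobInner (A - B) Q = frobInner A Q - frobInner B Q := by
  simp [frobInner, sub_mul]

theorem frobInner_neg_right {m n : ℕ} (A Q : Mat m n) :
    frobInner A (-Q) = -frobInner A Q := by
  simp [frobInner]

/-- **Polar alignment.** If `P = polar(M)`, then `⟨g, P⟩_F ≥ ‖g‖_* − 2‖g − M‖_*`. -/
theorem polar_alignment {m n : ℕ} (g M P : Mat m n) (hP : IsPolarFactor M P) :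
    nucNorm g - 2 * nucNorm (g - M) ≤ frobInner g P := by
  have hP₁ := hP.specNorm_le_one
  have h₁ := frobInner_le_nucNorm (g - M) ((specNorm_neg P).trans_le hP₁)
  rw [frobInner_neg_right, frobInner_sub_left] at h₁
  suffices h : nucNorm g ≤ frobInner g P + 2 * nucNorm (g - M) by linarith
  refine csSup_le ⟨_, P, hP₁, rfl⟩ ?_
  rintro c ⟨Q, hQ, rfl⟩
  have h₂ := frobInner_le_nucNorm (g - M) hQ
  rw [frobInner_sub_left] at h₂
  have h₃ := hP.frobInner_le hQ
  linarith
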